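/- Let a ≥ −1 be an integer, let ρ be the largest real root of f(x) = x³ − ax² − (a+3)x − 1, and let K = ℚ(ρ) be the corresponding simplest cubic field; assume O_K = ℤ[ρ]. Then an element of O_K^+ is indecomposable if and only if it is of the form ε·β, where ε is a totally positive unit of O_K and β belongs to the set {1, 1 + ρ + ρ²} ∪ {−v − wρ + (v+1)ρ² : v, w ∈ ℤ, 0 ≤ v ≤ a, v(a+2) + 1 ≤ w ≤ (v+1)(a+1)}. In particular, up to multiplication by totally positive units there are exactly 2 + (a² + 3a + 2)/2 indecomposable elements. -/

import Mathlib

open NumberField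

/-- The data of a commutative ring `ℤ[ρ]` with `ρ` a root of the Shanks polynomial
`x³ - ax² - (a+3)x - 1`, together with its three real embeddings; `top` sends `ρ` to the largest
root, `bot` to the smallest one and `mid` to the remaining one. -/
structure ShanksOrder (R : Type*) [CommRing R] (a : ℤ) where
  ρ : R
  top : R →+* ℝ
  bot : R →+* ℝ
  mid : R →+* ℝ
  neg_one_le : -1 ≤ a
  root : ρ ^ 3 - (a : R) * ρ ^ 2 - ((a : R) + 3) * ρ - 1 = 0
  exists_rep : ∀ α : R, ∃ x y z : ℤ, α = x + y * ρ + z * ρ ^ 2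
  lt_top : (a : ℝ) + 1 < top ρ
  top_pos : 0 < top ρ
  bot_ρ : bot ρ = -(1 + top ρ) / top ρ
  mid_ρ : mid ρ = -1 / (1 + top ρ)

namespace ShanksOrder

variable {R : Type*} [CommRing R] {a : ℤ} (S : ShanksOrder R a)

/-- Positivity at the three real embeddings. -/
def TotPos (α : R) : Prop := 0 < S.top α ∧ 0 < S.bot α ∧ 0 < S.mid α

/-- Elements that are not a sum of two totally positive elements. -/
def Indec (α : R) : Prop := ¬ ∃ β γ : R, S.TotPos β ∧ S.TotPos γ ∧ α = β + γ

/-- The linear functional `x + yρ + zρ² ↦ x + z`, written as a trace form. -/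
noncomputable def outer (α : R) : ℝ :=
  (S.top α * (1 + S.top S.ρ) ^ 2 + S.bot α * S.top S.ρ ^ 2 +
    S.mid α * (S.top S.ρ ^ 2 * (1 + S.top S.ρ) ^ 2)) / (S.top S.ρ ^ 2 + S.top S.ρ + 1) ^ 2

/-- The linear functional `x + yρ + zρ² ↦ 2x - y + 2z`, written as a trace form. -/
noncomputable def inner (α : R) : ℝ :=
  (S.top α + S.bot α * S.top S.ρ ^ 2 + S.mid α * (1 + S.top S.ρ) ^ 2) /
    (S.top S.ρ ^ 2 + S.top S.ρ + 1)

lemma outer_add (α β : R) : S.outer (α + β) = S.outer α + S.outer β := by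
  simp only [outer, map_add]; ring

lemma outer_intCast_mul (n : ℤ) (α : R) : S.outer (n * α) = n * S.outer α := by
  simp only [outer, map_mul, map_intCast]; ring

lemma outer_rep (x y z : ℤ) : S.outer (x + y * S.ρ + z * S.ρ ^ 2) = x + z := by
  have h := S.top_pos
  simp only [outer, map_add, map_mul, map_pow, map_intCast, S.bot_ρ, S.mid_ρ]
  have h1 : 1 + S.top S.ρ ≠ 0 := by positivity
  have h2 : S.top S.ρ ^ 2 + S.top S.ρ + 1 ≠ 0 := by positivity
  field_simp
  ring

lemma inner_rep (x y z : ℤ) : S.inner (x + y * S.ρ + z * S.ρ ^ 2) = 2 * x - y + 2 * z := by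
  have h := S.top_pos
  simp only [inner, map_add, map_mul, map_pow, map_intCast, S.bot_ρ, S.mid_ρ]
  have h1 : 1 + S.top S.ρ ≠ 0 := by positivity
  have h2 : S.top S.ρ ^ 2 + S.top S.ρ + 1 ≠ 0 := by positivity
  field_simp
  ring

variable {S} in
lemma TotPos.outer_pos {α : R} (hα : S.TotPos α) : 0 < S.outer α := by
  obtain ⟨h1, h2, h3⟩ := hα
  have h := S.top_pos
  unfold outer
  positivity

variable {S} in
lemma TotPos.inner_pos {α : R} (hα : S.TotPos α) : 0 < S.inner α := by
  obtain ⟨h1, h2, h3⟩ := hα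
  have h := S.top_pos
  unfold inner
  positivity

lemma rep_inj {x y z x' y' z' : ℤ}
    (h : (x : R) + y * S.ρ + z * S.ρ ^ 2 = x' + y' * S.ρ + z' * S.ρ ^ 2) :
    x = x' ∧ y = y' ∧ z = z' := by
  have h1 := congrArg S.outer h
  have h2 := congrArg S.inner h
  have h3 := congrArg S.top h
  simp only [outer_rep, inner_rep] at h1 h2
  simp only [map_add, map_mul, map_pow, map_intCast] at h3
  have hy : (y : ℝ) = y' := by linarith
  rw [hy] at h3
  have ht := S.lt_top
  have ha : (-1 : ℝ) ≤ a := by exact_mod_cast S.neg_one_le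
  have hne : S.top S.ρ ^ 2 - 1 ≠ 0 := by
    intro h
    have h1 : S.top S.ρ = 1 := by nlinarith [S.top_pos]
    have h2 := congrArg S.top S.root
    simp only [map_sub, map_mul, map_pow, map_add, map_intCast, map_one, map_ofNat, map_zero,
      h1] at h2
    linarith
  have hz : (z : ℝ) = z' := by
    have : ((z : ℝ) - z') * (S.top S.ρ ^ 2 - 1) = 0 := by linear_combination h3 - h1
    rcases mul_eq_zero.mp this with h | h
    · linarith
    · exact absurd h hne
  have hx : (x : ℝ) = x' := by linarith
  exact ⟨by exact_mod_cast hx, by exact_mod_cast hy, by exact_mod_cast hz⟩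

lemma ρ_mul_rep (x y z : ℤ) : S.ρ * ((x : R) + y * S.ρ + z * S.ρ ^ 2) =
    (z : ℤ) + (x + (a + 3) * z : ℤ) * S.ρ + (y + a * z : ℤ) * S.ρ ^ 2 := by
  push_cast
  linear_combination (z : R) * S.root

lemma one_add_ρ_mul_rep (x y z : ℤ) : (1 + S.ρ) * ((x : R) + y * S.ρ + z * S.ρ ^ 2) =
    (x + z : ℤ) + (x + y + (a + 3) * z : ℤ) * S.ρ + (y + (a + 1) * z : ℤ) * S.ρ ^ 2 := by
  push_cast
  linear_combination (z : R) * S.root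

/-- `ρ` as a unit. -/
def unitρ : Rˣ :=
  Units.mkOfMulEqOne S.ρ (S.ρ ^ 2 - a * S.ρ - (a + 3)) (by linear_combination S.root)

/-- `1 + ρ` as a unit. -/
def unitOneAddρ : Rˣ :=
  Units.mkOfMulEqOne (1 + S.ρ) (2 + (a + 1) * S.ρ - S.ρ ^ 2) (by linear_combination -S.root)

@[simp] lemma val_unitρ : (S.unitρ : R) = S.ρ := rfl

@[simp] lemma val_unitOneAddρ : (S.unitOneAddρ : R) = 1 + S.ρ := rfl

lemma unitρ_inv_mul_rep (x y z : ℤ) :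
    ((S.unitρ⁻¹ : Rˣ) : R) * ((x : R) + y * S.ρ + z * S.ρ ^ 2) =
      (y - (a + 3) * x : ℤ) + (z - a * x : ℤ) * S.ρ + (x : ℤ) * S.ρ ^ 2 := by
  rw [Units.inv_mul_eq_iff_eq_mul, val_unitρ, ρ_mul_rep]
  congr 3 <;> ring_nf

lemma unitOneAddρ_inv_mul_rep (x y z : ℤ) :
    ((S.unitOneAddρ⁻¹ : Rˣ) : R) * ((x : R) + y * S.ρ + z * S.ρ ^ 2) =
      (2 * x - y + z : ℤ) + (z - (a + 1) * (y - z - x) : ℤ) * S.ρ + (y - z - x : ℤ) * S.ρ ^ 2 := by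
  rw [Units.inv_mul_eq_iff_eq_mul, val_unitOneAddρ, one_add_ρ_mul_rep]
  congr 3 <;> ring_nf

/-- The unit `(ρ / (1 + ρ))²`, the third vertex of the second cone. -/
def vertex : Rˣ := (S.unitρ * S.unitOneAddρ⁻¹) ^ 2

lemma val_vertex : (S.vertex : R) =
    (-(a + 1) : ℤ) + (-(a ^ 2 + 3 * a + 3) : ℤ) * S.ρ + (a + 2 : ℤ) * S.ρ ^ 2 := by
  have h : (S.vertex : R) = ((S.unitOneAddρ⁻¹ : Rˣ) : R) * (((S.unitOneAddρ⁻¹ : Rˣ) : R) *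
      (((0 : ℤ) : R) + (0 : ℤ) * S.ρ + (1 : ℤ) * S.ρ ^ 2)) := by
    simp [vertex]; ring
  rw [h, unitOneAddρ_inv_mul_rep, unitOneAddρ_inv_mul_rep]
  congr 3 <;> ring_nf

lemma totPos_sq (u : Rˣ) : S.TotPos ((u ^ 2 : Rˣ) : R) := by
  have h (φ : R →+* ℝ) : 0 < φ ((u ^ 2 : Rˣ) : R) := by
    have : φ u ≠ 0 := (u.isUnit.map φ).ne_zero
    rw [Units.val_pow_eq_pow_val, map_pow]
    positivity
  exact ⟨h _, h _, h _⟩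

lemma totPos_one : S.TotPos 1 := by simp [TotPos]

lemma totPos_ρ_sq : S.TotPos (S.ρ ^ 2) := S.totPos_sq S.unitρ

lemma totPos_one_add_ρ_sq : S.TotPos ((1 + S.ρ) ^ 2) := S.totPos_sq S.unitOneAddρ

lemma totPos_vertex : S.TotPos S.vertex := S.totPos_sq _

variable {S}

lemma TotPos.add {α β : R} (hα : S.TotPos α) (hβ : S.TotPos β) : S.TotPos (α + β) := by
  simp only [TotPos, map_add] at *
  exact ⟨add_pos hα.1 hβ.1, add_pos hα.2.1 hβ.2.1, add_pos hα.2.2 hβ.2.2⟩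

lemma TotPos.mul {α β : R} (hα : S.TotPos α) (hβ : S.TotPos β) : S.TotPos (α * β) := by
  simp only [TotPos, map_mul] at *
  exact ⟨mul_pos hα.1 hβ.1, mul_pos hα.2.1 hβ.2.1, mul_pos hα.2.2 hβ.2.2⟩

lemma TotPos.inv {u : Rˣ} (hu : S.TotPos u) : S.TotPos ((u⁻¹ : Rˣ) : R) := by
  have h : ((u⁻¹ : Rˣ) : R) = ((u⁻¹ ^ 2 : Rˣ) : R) * u := by simp [pow_two, mul_assoc]
  rw [h]
  exact (S.totPos_sq _).mul hu

lemma Indec.unit_mul {u : Rˣ} (hu : S.TotPos u) {α : R} (hα : S.Indec α) :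
    S.Indec (u * α) := by
  rintro ⟨β, γ, hβ, hγ, h⟩
  refine hα ⟨_, _, hu.inv.mul hβ, hu.inv.mul hγ, ?_⟩
  rw [← mul_add, ← h, Units.inv_mul_cancel_left]

variable (S)

lemma exists_outer (α : R) : ∃ n : ℤ, S.outer α = n := by
  obtain ⟨x, y, z, rfl⟩ := S.exists_rep α
  exact ⟨x + z, by rw [outer_rep]; push_cast; rfl⟩

lemma exists_inner (α : R) : ∃ n : ℤ, S.inner α = n := by
  obtain ⟨x, y, z, rfl⟩ := S.exists_rep α
  exact ⟨2 * x - y + 2 * z, by rw [inner_rep]; push_cast; rfl⟩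

variable {S} in
lemma TotPos.one_le_outer {α : R} (hα : S.TotPos α) : 1 ≤ S.outer α := by
  obtain ⟨n, hn⟩ := S.exists_outer α
  have h := hα.outer_pos
  rw [hn] at h ⊢
  have h' : 0 < n := by exact_mod_cast h
  exact_mod_cast h'

lemma indec_of_outer_eq_one {α : R} (hα : S.outer α = 1) : S.Indec α := by
  rintro ⟨β, γ, hβ, hγ, rfl⟩
  rw [outer_add] at hα
  linarith [hβ.one_le_outer, hγ.one_le_outer]

/-- A nonzero combination of three totally positive elements with nonnegative coefficients,
scaled by a positive integer, is totally positive. -/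
lemma totPos_of_mul_eq {d p q r : ℤ} {α u v w : R} (hd : 0 < d) (hp : 0 ≤ p) (hq : 0 ≤ q)
    (hr : 0 ≤ r) (hpos : 0 < p + q + r) (hu : S.TotPos u) (hv : S.TotPos v) (hw : S.TotPos w)
    (h : (d : R) * α = p * u + q * v + r * w) : S.TotPos α := by
  have key (φ : R →+* ℝ) (h1 : 0 < φ u) (h2 : 0 < φ v) (h3 : 0 < φ w) : 0 < φ α := by
    have e := congrArg φ h
    simp only [map_add, map_mul, map_intCast] at e
    have hd' : (0 : ℝ) < d := by exact_mod_cast hd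
    have hp' : (0 : ℝ) ≤ p := by exact_mod_cast hp
    have hq' : (0 : ℝ) ≤ q := by exact_mod_cast hq
    have hr' : (0 : ℝ) ≤ r := by exact_mod_cast hr
    have hs' : (0 : ℝ) < p + q + r := by exact_mod_cast hpos
    refine pos_of_mul_pos_right (a := (d : ℝ)) ?_ hd'.le
    rw [e]
    by_contra hneg
    have i1 := mul_nonneg hp' h1.le
    have i2 := mul_nonneg hq' h2.le
    have i3 := mul_nonneg hr' h3.le
    have z1 : (p : ℝ) = 0 := by
      rcases mul_eq_zero.mp (le_antisymm (by linarith) i1) with h | h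
      · exact h
      · linarith
    have z2 : (q : ℝ) = 0 := by
      rcases mul_eq_zero.mp (le_antisymm (by linarith) i2) with h | h
      · exact h
      · linarith
    have z3 : (r : ℝ) = 0 := by
      rcases mul_eq_zero.mp (le_antisymm (by linarith) i3) with h | h
      · exact h
      · linarith
    linarith
  exact ⟨key _ hu.1 hv.1 hw.1, key _ hu.2.1 hv.2.1 hw.2.1, key _ hu.2.2 hv.2.2 hw.2.2⟩

lemma totPos_of_mem_cone {x y z : ℤ} (hy : y ≤ 0) (hx : (a + 1) * y ≤ (a ^ 2 + 3 * a + 3) * x)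
    (hz : 0 ≤ (a ^ 2 + 3 * a + 3) * z + (a + 2) * y) (hxz : 0 < x + z) :
    S.TotPos ((x : R) + y * S.ρ + z * S.ρ ^ 2) := by
  have ha := S.neg_one_le
  have hD : 0 < a ^ 2 + 3 * a + 3 := by nlinarith
  refine S.totPos_of_mul_eq (d := a ^ 2 + 3 * a + 3)
    (p := (a ^ 2 + 3 * a + 3) * x - (a + 1) * y) (q := (a ^ 2 + 3 * a + 3) * z + (a + 2) * y)
    (r := -y) hD (by linarith) hz (by linarith) ?_ S.totPos_one S.totPos_ρ_sq S.totPos_vertex ?_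
  · linarith [mul_pos hD hxz]
  · rw [val_vertex]
    push_cast
    ring

lemma totPos_of_mem_cone' {x y z : ℤ} (hy : 0 ≤ y) (hx : y ≤ 2 * x) (hz : y ≤ 2 * z)
    (h : 0 < x + z) : S.TotPos ((x : R) + y * S.ρ + z * S.ρ ^ 2) := by
  refine S.totPos_of_mul_eq (d := 2) (p := 2 * x - y) (q := 2 * z - y) (r := y) two_pos
    (by linarith) (by linarith) hy (by linarith) S.totPos_one S.totPos_ρ_sq
    S.totPos_one_add_ρ_sq ?_
  push_cast
  ring

/-- The lattice points in the interior of the triangle with vertices `1`, `ρ²`, `vertex`. -/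
def triangle : Set R :=
  {x : R | ∃ v w : ℤ, 0 ≤ v ∧ v ≤ a ∧ v * (a + 2) + 1 ≤ w ∧ w ≤ (v + 1) * (a + 1) ∧
    x = -(v : R) - (w : R) * S.ρ + ((v : R) + 1) * S.ρ ^ 2}

variable {S}

lemma totPos_of_mem_triangle {α : R} (hα : α ∈ S.triangle) : S.TotPos α := by
  obtain ⟨v, w, hv, hva, hw, hw', rfl⟩ := hα
  have := S.totPos_of_mem_cone (x := -v) (y := -w) (z := v + 1) (by nlinarith [S.neg_one_le])
    (by nlinarith) (by nlinarith) (by linarith)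
  push_cast at this
  convert this using 1
  ring

lemma outer_of_mem_triangle {α : R} (hα : α ∈ S.triangle) : S.outer α = 1 := by
  obtain ⟨v, w, -, -, -, -, rfl⟩ := hα
  have := S.outer_rep (-v) (-w) (v + 1)
  push_cast at this
  rw [show (1 : ℝ) = -v + (v + 1) by ring, ← this]
  congr 1
  ring

variable (S)

lemma outer_one : S.outer 1 = 1 := by simpa using S.outer_rep 1 0 0

lemma outer_one_add_ρ_add_ρ_sq : S.outer (1 + S.ρ + S.ρ ^ 2) = 2 := by
  have := S.outer_rep 1 1 1
  norm_num at this
  exact this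

lemma totPos_one_add_ρ_add_ρ_sq : S.TotPos (1 + S.ρ + S.ρ ^ 2) := by
  simpa using S.totPos_of_mem_cone' (x := 1) (y := 1) (z := 1) (by simp) (by simp) (by simp)
    (by simp)

lemma not_totPos_of_nonneg {v w : ℤ} (hv : 0 ≤ v)
    (h₁ : S.TotPos (-(v : R) - w * S.ρ + (v + 1) * S.ρ ^ 2))
    (h₂ : S.TotPos ((v + 1 : R) + (w + 1) * S.ρ - v * S.ρ ^ 2)) : False := by
  have ht := S.top_pos
  have hv' : (0 : ℝ) ≤ v := by exact_mod_cast hv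
  have hr := h₁.2.2
  have hs := h₂.2.1
  simp only [map_add, map_sub, map_neg, map_mul, map_pow, map_intCast, map_one] at hr hs
  set s := S.bot S.ρ with hs_def
  set r := S.mid S.ρ with hr_def
  have hs1 : s < -1 := by
    rw [hs_def, S.bot_ρ, div_lt_iff₀ ht]; linarith
  have hr0 : r < 0 := by
    rw [hr_def, S.mid_ρ]; exact div_neg_of_neg_of_pos (by norm_num) (by linarith)
  have hr1 : -1 < r := by
    rw [hr_def, S.mid_ρ, lt_div_iff₀ (by linarith)]; linarith
  have hw : w + 1 < 1 := by
    by_contra! hw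
    have hw' : (1 : ℝ) ≤ w + 1 := by exact_mod_cast hw
    nlinarith [mul_nonneg hv' (by nlinarith : (0 : ℝ) ≤ s ^ 2 - 1)]
  have hw' : (w : ℝ) ≤ -1 := by
    have : w ≤ -1 := by omega
    exact_mod_cast this
  nlinarith [mul_nonneg hv' (by nlinarith : (0 : ℝ) ≤ 1 - r ^ 2)]

lemma indec_one_add_ρ_add_ρ_sq : S.Indec (1 + S.ρ + S.ρ ^ 2) := by
  rintro ⟨β, γ, hβ, hγ, h⟩
  have hL := S.outer_one_add_ρ_add_ρ_sq
  rw [h, outer_add] at hL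
  obtain ⟨x, y, z, rfl⟩ := S.exists_rep β
  have hβ1 : S.outer ((x : R) + y * S.ρ + z * S.ρ ^ 2) = 1 := by
    linarith [hβ.one_le_outer, hγ.one_le_outer]
  rw [outer_rep] at hβ1
  have hz : z = 1 - x := by
    have : x + z = 1 := by exact_mod_cast hβ1
    linarith
  subst hz
  obtain rfl : γ = 1 + S.ρ + S.ρ ^ 2 - ((x : R) + y * S.ρ + (1 - x : ℤ) * S.ρ ^ 2) := by
    rw [h]; ring
  push_cast at hβ hγ
  rcases le_or_gt x 0 with hx | hx
  · refine S.not_totPos_of_nonneg (v := -x) (w := -y) (by linarith) ?_ ?_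
    · convert hβ using 1; push_cast; ring
    · convert hγ using 1; push_cast; ring
  · refine S.not_totPos_of_nonneg (v := x - 1) (w := y - 1) (by linarith) ?_ ?_
    · convert hγ using 1; push_cast; ring
    · convert hβ using 1; push_cast; ring

lemma mem_of_indec_of_mem_cone {x y z : ℤ} (hy : y ≤ 0)
    (hx : (a + 1) * y ≤ (a ^ 2 + 3 * a + 3) * x)
    (hz : 0 ≤ (a ^ 2 + 3 * a + 3) * z + (a + 2) * y) (hxz : 0 < x + z)
    (hind : S.Indec ((x : R) + y * S.ρ + z * S.ρ ^ 2)) :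
    (x : R) + y * S.ρ + z * S.ρ ^ 2 = 1 ∨ (x : R) + y * S.ρ + z * S.ρ ^ 2 = S.ρ ^ 2 ∨
      (x : R) + y * S.ρ + z * S.ρ ^ 2 = S.vertex ∨
      (x : R) + y * S.ρ + z * S.ρ ^ 2 ∈ S.triangle := by
  have ha := S.neg_one_le
  obtain ⟨D, hD⟩ : ∃ D, D = a ^ 2 + 3 * a + 3 := ⟨_, rfl⟩
  have hD0 : 0 < D := by nlinarith
  have hmul : (a + 1) * (a + 2) = D - 1 := by rw [hD]; ring
  rw [← hD] at hx hz
  have hcone {x y z : ℤ} (hy : y ≤ 0) (hx : (a + 1) * y ≤ D * x) (hz : 0 ≤ D * z + (a + 2) * y)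
      (hxz : 0 < x + z) : S.TotPos ((x : R) + y * S.ρ + z * S.ρ ^ 2) := by
    rw [hD] at hx hz
    exact S.totPos_of_mem_cone hy hx hz hxz
  rcases le_or_gt (D + (a + 1) * y) (D * x) with hp | hp
  · rcases le_or_gt (x + z) 1 with h1 | h1
    · left
      have hz1 : z = 1 - x := by linarith
      subst hz1
      obtain rfl : y = 0 := by nlinarith
      obtain rfl : x = 1 := by nlinarith
      simp
    · refine absurd ⟨1, _, S.totPos_one, hcone (x := x - 1) hy (by linarith) hz (by linarith), ?_⟩
        hind
      push_cast; ring
  rcases le_or_gt D (D * z + (a + 2) * y) with hq | hq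
  · rcases le_or_gt (x + z) 1 with h1 | h1
    · right; left
      have hz1 : z = 1 - x := by linarith
      subst hz1
      obtain rfl : y = 0 := by nlinarith
      obtain rfl : x = 0 := by nlinarith
      simp
    · refine absurd ⟨_, _, S.totPos_ρ_sq,
        hcone (z := z - 1) hy hx (by linarith) (by linarith), ?_⟩ hind
      push_cast; ring
  rcases le_or_gt y (-D) with hr | hr
  · rcases le_or_gt (x + z) 1 with h1 | h1
    · right; right; left
      have hz1 : z = 1 - x := by linarith
      subst hz1
      obtain rfl : y = -D := by nlinarith
      obtain rfl : x = -(a + 1) := by nlinarith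
      rw [val_vertex, hD]
      push_cast; ring
    · refine absurd ⟨_, _, S.totPos_vertex,
        hcone (x := x + (a + 1)) (y := y + D) (z := z - (a + 2)) (by linarith) (by nlinarith)
          (by nlinarith) (by linarith), ?_⟩ hind
      rw [val_vertex, hD]
      push_cast; ring
  have hxz3 : x + z < 3 := by nlinarith
  have hcases : x + z = 1 ∨ x + z = 2 := by omega
  rcases hcases with h1 | h2
  · obtain ⟨v, rfl⟩ : ∃ v, x = -v := ⟨-x, by ring⟩
    obtain ⟨w, rfl⟩ : ∃ w, y = -w := ⟨-y, by ring⟩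
    obtain rfl : z = v + 1 := by linarith
    have hv : 0 ≤ v := by
      have : 0 < v + 1 := pos_of_mul_pos_right (a := D) (by nlinarith) hD0.le
      omega
    have hw : 0 < w := pos_of_mul_pos_right (a := a + 2) (by nlinarith) (by linarith)
    have ha0 : 0 ≤ a := by
      by_contra! h
      obtain rfl : a = -1 := by omega
      omega
    right; right; right
    refine ⟨v, w, hv, ?_, ?_, ?_, by push_cast; ring⟩
    · have : v < a + 1 := lt_of_mul_lt_mul_left (a := D) (by nlinarith) hD0.le
      omega
    · by_contra! h
      have h' : w ≤ v * (a + 2) := by omega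
      have h'' := mul_le_mul_of_nonneg_left h' (show 0 ≤ a + 1 by linarith)
      have hv0 : v ≤ 0 := by nlinarith
      obtain rfl : v = 0 := by omega
      omega
    · by_contra! h
      have h' := mul_le_mul_of_nonneg_left (Int.add_one_le_iff.mpr h)
        (show 0 ≤ a + 2 by linarith)
      have hva : v < a + 1 := lt_of_mul_lt_mul_left (a := D) (by nlinarith) hD0.le
      nlinarith
  · obtain ⟨v, rfl⟩ : ∃ v, x = -v := ⟨-x, by ring⟩
    obtain ⟨w, rfl⟩ : ∃ w, y = -w := ⟨-y, by ring⟩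
    obtain rfl : z = v + 2 := by linarith
    have ha0 : 0 ≤ a := by
      by_contra! h
      obtain rfl : a = -1 := by omega
      obtain rfl : D = 1 := by rw [hD]; norm_num
      omega
    have hv : 0 ≤ v := by
      have : 0 < v + 1 := pos_of_mul_pos_right (a := D) (by nlinarith) hD0.le
      omega
    have hva : v < a + 1 := lt_of_mul_lt_mul_left (a := D) (by nlinarith) hD0.le
    have hw_le : w ≤ (v + 1) * (a + 2) := by
      by_contra! h
      have h' := mul_le_mul_of_nonneg_left (Int.add_one_le_iff.mpr h)
        (show 0 ≤ a + 1 by linarith)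
      nlinarith
    have hw_ge : v * (a + 1) + a + 2 ≤ w := by
      by_contra! h
      have h' : w ≤ (v + 1) * (a + 1) := by linarith
      have h'' := mul_le_mul_of_nonneg_left h' (show 0 ≤ a + 2 by linarith)
      nlinarith
    refine absurd ⟨_, _, totPos_of_mem_triangle
      ⟨v, v * (a + 2) + 1, hv, by linarith, le_rfl, by nlinarith, rfl⟩,
      totPos_of_mem_triangle
        ⟨0, w - (v * (a + 2) + 1), le_rfl, ha0, by nlinarith, by nlinarith, rfl⟩, ?_⟩ hind
    push_cast
    ring

lemma mem_of_indec_of_mem_cone' {x y z : ℤ} (hy : 0 ≤ y) (hx : y ≤ 2 * x) (hz : y ≤ 2 * z)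
    (hxz : 0 < x + z) (hind : S.Indec ((x : R) + y * S.ρ + z * S.ρ ^ 2)) :
    (x : R) + y * S.ρ + z * S.ρ ^ 2 = 1 ∨ (x : R) + y * S.ρ + z * S.ρ ^ 2 = S.ρ ^ 2 ∨
      (x : R) + y * S.ρ + z * S.ρ ^ 2 = (1 + S.ρ) ^ 2 ∨
      (x : R) + y * S.ρ + z * S.ρ ^ 2 = 1 + S.ρ + S.ρ ^ 2 := by
  rcases le_or_gt (y + 2) (2 * x) with hp | hp
  · rcases le_or_gt (x + z) 1 with h1 | h1
    · obtain ⟨rfl, rfl, rfl⟩ : x = 1 ∧ y = 0 ∧ z = 0 := by omega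
      simp
    · refine absurd ⟨1, _, S.totPos_one, S.totPos_of_mem_cone' (x := x - 1) hy (by linarith) hz
        (by linarith), ?_⟩ hind
      push_cast; ring
  rcases le_or_gt (y + 2) (2 * z) with hq | hq
  · rcases le_or_gt (x + z) 1 with h1 | h1
    · obtain ⟨rfl, rfl, rfl⟩ : x = 0 ∧ y = 0 ∧ z = 1 := by omega
      simp
    · refine absurd ⟨_, _, S.totPos_ρ_sq, S.totPos_of_mem_cone' (z := z - 1) hy hx (by linarith)
        (by linarith), ?_⟩ hind
      push_cast; ring
  rcases le_or_gt 2 y with hr | hr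
  · rcases le_or_gt (x + z) 2 with h1 | h1
    · obtain ⟨rfl, rfl, rfl⟩ : x = 1 ∧ y = 2 ∧ z = 1 := by omega
      right; right; left
      push_cast; ring
    · refine absurd ⟨_, _, S.totPos_one_add_ρ_sq, S.totPos_of_mem_cone' (x := x - 1) (y := y - 2)
        (z := z - 1) (by linarith) (by linarith) (by linarith) (by linarith), ?_⟩ hind
      push_cast; ring
  obtain ⟨rfl, rfl, rfl⟩ : x = 1 ∧ y = 1 ∧ z = 1 := by omega
  simp

variable {S} in
/-- Every orbit of totally positive elements under totally positive units contains an element at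
which one of the functionals `2 * outer` and `inner` attains its minimum over both functionals and
the whole orbit. -/
lemma TotPos.exists_reduced {α : R} (hα : S.TotPos α) : ∃ u : Rˣ, S.TotPos u ∧
    ((∀ u' : Rˣ, S.TotPos u' → 2 * S.outer (u * α) ≤ S.inner (u' * (u * α))) ∨
      ∀ u' : Rˣ, S.TotPos u' → S.inner (u * α) ≤ 2 * S.outer (u' * (u * α))) := by
  classical
  let p : ℕ → Prop := fun n ↦
    ∃ u : Rˣ, S.TotPos u ∧ (2 * S.outer (u * α) = n ∨ S.inner (u * α) = n)
  have hnat {x : ℝ} (hx : 0 < x) (h : ∃ n : ℤ, x = n) : ∃ n : ℕ, x = n := by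
    obtain ⟨n, rfl⟩ := h
    lift n to ℕ using by exact_mod_cast hx.le
    exact ⟨n, by simp⟩
  have hinner (u : Rˣ) (hu : S.TotPos u) : ∃ n : ℕ, S.inner (u * α) = n :=
    hnat (hu.mul hα).inner_pos (S.exists_inner _)
  have houter (u : Rˣ) (hu : S.TotPos u) : ∃ n : ℕ, 2 * S.outer (u * α) = n := by
    obtain ⟨n, hn⟩ := hnat (hu.mul hα).outer_pos (S.exists_outer _)
    exact ⟨2 * n, by rw [hn]; push_cast; rfl⟩
  have hp : ∃ n, p n := by
    obtain ⟨n, hn⟩ := hinner 1 S.totPos_one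
    exact ⟨n, 1, S.totPos_one, Or.inr hn⟩
  obtain ⟨u, hu, h⟩ := Nat.find_spec hp
  refine ⟨u, hu, h.imp (fun h u' hu' ↦ ?_) (fun h u' hu' ↦ ?_)⟩
  · have hu2 : S.TotPos ((u' * u : Rˣ) : R) := by simpa using hu'.mul hu
    obtain ⟨n, hn⟩ := hinner _ hu2
    have := Nat.find_min' hp ⟨_, hu2, Or.inr hn⟩
    rw [h, ← mul_assoc, ← Units.val_mul, hn]
    exact_mod_cast this
  · have hu2 : S.TotPos ((u' * u : Rˣ) : R) := by simpa using hu'.mul hu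
    obtain ⟨n, hn⟩ := houter _ hu2
    have := Nat.find_min' hp ⟨_, hu2, Or.inl hn⟩
    rw [h, ← mul_assoc, ← Units.val_mul, hn]
    exact_mod_cast this

lemma sq_mul_eq (c d : R) : c ^ 2 * d = c * (c * d) := by ring

lemma outer_ρ_sq_mul_rep (x y z : ℤ) : S.outer (S.ρ ^ 2 * (x + y * S.ρ + z * S.ρ ^ 2)) =
    x + (a + 1) * y + (a ^ 2 + 2 * a + 3) * z := by
  rw [sq_mul_eq, ρ_mul_rep, ρ_mul_rep, outer_rep]
  push_cast; ring

lemma outer_vertex_mul_rep (x y z : ℤ) : S.outer (S.vertex * (x + y * S.ρ + z * S.ρ ^ 2)) =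
    x - y + 2 * z := by
  have h : (S.vertex : R) = S.ρ * (S.ρ * (((S.unitOneAddρ⁻¹ : Rˣ) : R) *
      ((S.unitOneAddρ⁻¹ : Rˣ) : R))) := by
    simp [vertex]; ring
  rw [h]
  simp only [mul_assoc]
  rw [unitOneAddρ_inv_mul_rep, unitOneAddρ_inv_mul_rep, ρ_mul_rep, ρ_mul_rep, outer_rep]
  push_cast; ring

lemma mem_of_indec_of_outer_le {β : R} (hβ : S.TotPos β) (hind : S.Indec β)
    (h : ∀ u : Rˣ, S.TotPos u → 2 * S.outer β ≤ S.inner (u * β)) :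
    β = 1 ∨ β = S.ρ ^ 2 ∨ β = S.vertex ∨ β ∈ S.triangle := by
  obtain ⟨x, y, z, rfl⟩ := S.exists_rep β
  have h0 := hβ.outer_pos
  have h1 := h 1 S.totPos_one
  have h2 := h (S.unitOneAddρ ^ 2) (S.totPos_sq _)
  have h3 := h ((S.unitOneAddρ * S.unitρ⁻¹) ^ 2) (S.totPos_sq _)
  have e : (((S.unitOneAddρ * S.unitρ⁻¹) ^ 2 : Rˣ) : R) =
      (1 + S.ρ) * ((1 + S.ρ) * (((S.unitρ⁻¹ : Rˣ) : R) * ((S.unitρ⁻¹ : Rˣ) : R))) := by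
    simp; ring
  rw [Units.val_one, one_mul, outer_rep, inner_rep] at h1
  rw [Units.val_pow_eq_pow_val, val_unitOneAddρ, sq_mul_eq, one_add_ρ_mul_rep,
    one_add_ρ_mul_rep, outer_rep, inner_rep] at h2
  rw [e] at h3
  simp only [mul_assoc] at h3
  rw [unitρ_inv_mul_rep, unitρ_inv_mul_rep, one_add_ρ_mul_rep,
    one_add_ρ_mul_rep, outer_rep, inner_rep] at h3
  rw [outer_rep] at h0
  norm_cast at h0 h1 h2 h3
  exact S.mem_of_indec_of_mem_cone (by linarith) (by linarith) (by linarith) h0 hind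

lemma mem_of_indec_of_inner_le {β : R} (hβ : S.TotPos β) (hind : S.Indec β)
    (h : ∀ u : Rˣ, S.TotPos u → S.inner β ≤ 2 * S.outer (u * β)) :
    β = 1 ∨ β = S.ρ ^ 2 ∨ β = (1 + S.ρ) ^ 2 ∨ β = 1 + S.ρ + S.ρ ^ 2 := by
  obtain ⟨x, y, z, rfl⟩ := S.exists_rep β
  have h0 := hβ.outer_pos
  have h1 := h 1 S.totPos_one
  have h2 := h ((S.unitOneAddρ⁻¹) ^ 2) (S.totPos_sq _)
  have h3 := h S.vertex S.totPos_vertex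
  rw [Units.val_one, one_mul, outer_rep, inner_rep] at h1
  rw [Units.val_pow_eq_pow_val, sq_mul_eq, unitOneAddρ_inv_mul_rep,
    unitOneAddρ_inv_mul_rep, outer_rep, inner_rep] at h2
  rw [outer_vertex_mul_rep, inner_rep] at h3
  rw [outer_rep] at h0
  norm_cast at h0 h1 h2 h3
  exact S.mem_of_indec_of_mem_cone' (by linarith) (by linarith) (by linarith) h0 hind

/-- Representatives of the indecomposables up to totally positive units. -/
def representatives : Set R := {1, 1 + S.ρ + S.ρ ^ 2} ∪ S.triangle

lemma indec_of_mem_representatives {β : R} (hβ : β ∈ S.representatives) : S.Indec β := by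
  rcases hβ with (rfl | rfl) | h
  · exact S.indec_of_outer_eq_one S.outer_one
  · exact S.indec_one_add_ρ_add_ρ_sq
  · exact S.indec_of_outer_eq_one (outer_of_mem_triangle h)

theorem indec_iff {α : R} (hα : S.TotPos α) : S.Indec α ↔
    ∃ ε : Rˣ, S.TotPos ε ∧ ∃ β ∈ S.representatives, α = ε * β := by
  constructor
  · intro hind
    obtain ⟨u, hu, h⟩ := hα.exists_reduced
    have hβ := hu.mul hα
    have hindβ := hind.unit_mul hu
    suffices h' : ∃ v : Rˣ, S.TotPos v ∧ ∃ β ∈ S.representatives, u * α = v * β by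
      obtain ⟨v, hv, β, hβ, e⟩ := h'
      refine ⟨u⁻¹ * v, ?_, β, hβ, ?_⟩
      · simpa using hu.inv.mul hv
      · rw [Units.val_mul, mul_assoc, ← e, Units.inv_mul_cancel_left]
    have hone : (1 : R) ∈ S.representatives := Or.inl (Or.inl rfl)
    have hunit (v : Rˣ) (hv : S.TotPos v) (e : u * α = v) :
        ∃ v : Rˣ, S.TotPos v ∧ ∃ β ∈ S.representatives, u * α = v * β :=
      ⟨v, hv, 1, hone, by rw [e, mul_one]⟩
    rcases h with h | h
    · rcases S.mem_of_indec_of_outer_le hβ hindβ h with e | e | e | e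
      · exact hunit 1 S.totPos_one e
      · exact hunit (S.unitρ ^ 2) S.totPos_ρ_sq e
      · exact hunit S.vertex S.totPos_vertex e
      · exact ⟨1, S.totPos_one, _, Or.inr e, by simp⟩
    · rcases S.mem_of_indec_of_inner_le hβ hindβ h with e | e | e | e
      · exact hunit 1 S.totPos_one e
      · exact hunit (S.unitρ ^ 2) S.totPos_ρ_sq e
      · exact hunit (S.unitOneAddρ ^ 2) S.totPos_one_add_ρ_sq e
      · exact ⟨1, S.totPos_one, _, Or.inl (Or.inr rfl), by simp [e]⟩
  · rintro ⟨ε, hε, β, hβ, rfl⟩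
    exact (S.indec_of_mem_representatives hβ).unit_mul hε

lemma eq_one_of_outer_eq_one {ε : R} (h₁ : S.outer ε = 1) (h₂ : S.outer (S.ρ ^ 2 * ε) = 1)
    (h₃ : S.outer (S.vertex * ε) = 1) : ε = 1 := by
  obtain ⟨x, y, z, rfl⟩ := S.exists_rep ε
  rw [outer_rep] at h₁
  rw [outer_ρ_sq_mul_rep] at h₂
  rw [outer_vertex_mul_rep] at h₃
  norm_cast at h₁ h₂ h₃
  have hz : z = y := by linarith
  subst hz
  have hD : a ^ 2 + 3 * a + 3 ≠ 0 := by nlinarith [S.neg_one_le]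
  obtain rfl : z = 0 := by
    refine (mul_eq_zero.mp (?_ : (a ^ 2 + 3 * a + 3) * z = 0)).resolve_left hD
    linarith
  obtain rfl : x = 1 := by linarith
  simp

lemma eq_one_of_mul_mem_triangle {ε : R} (hε : S.TotPos ε) {β : R} (hβ : β ∈ S.triangle)
    (h : S.outer (ε * β) = 1) : ε = 1 := by
  obtain ⟨v, w, hv, hva, hw, hw', rfl⟩ := hβ
  obtain ⟨p, hp⟩ : ∃ p, p = -(a ^ 2 + 3 * a + 3) * v + (a + 1) * w := ⟨_, rfl⟩
  obtain ⟨q, hq⟩ : ∃ q, q = (a ^ 2 + 3 * a + 3) * (v + 1) - (a + 2) * w := ⟨_, rfl⟩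
  have hp0 : 0 < p := by nlinarith
  have hq0 : 0 < q := by nlinarith
  have hw0 : 0 < w := by nlinarith
  have e : ((a ^ 2 + 3 * a + 3 : ℤ) : R) * (ε * (-(v : R) - w * S.ρ + (v + 1) * S.ρ ^ 2)) =
      (p : R) * ε + (q : R) * (S.ρ ^ 2 * ε) + (w : R) * (S.vertex * ε) := by
    rw [val_vertex, hp, hq]
    push_cast; ring
  have e' := congrArg S.outer e
  rw [outer_add, outer_add, outer_intCast_mul, outer_intCast_mul, outer_intCast_mul,
    outer_intCast_mul, h, mul_one] at e'
  have hsum : ((a ^ 2 + 3 * a + 3 : ℤ) : ℝ) = p + q + w := by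
    rw [hp, hq]; push_cast; ring
  rw [hsum] at e'
  have i1 := hε.one_le_outer
  have i2 := (S.totPos_ρ_sq.mul hε).one_le_outer
  have i3 := (S.totPos_vertex.mul hε).one_le_outer
  have hp1 : (0 : ℝ) < p := by exact_mod_cast hp0
  have hq1 : (0 : ℝ) < q := by exact_mod_cast hq0
  have hw1 : (0 : ℝ) < w := by exact_mod_cast hw0
  have j1 := mul_nonneg hp1.le (sub_nonneg.mpr i1)
  have j2 := mul_nonneg hq1.le (sub_nonneg.mpr i2)
  have j3 := mul_nonneg hw1.le (sub_nonneg.mpr i3)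
  refine S.eq_one_of_outer_eq_one ?_ ?_ ?_
  · have := (mul_eq_zero.mp (show (p : ℝ) * (S.outer ε - 1) = 0 by linarith)).resolve_left hp1.ne'
    linarith
  · have := (mul_eq_zero.mp (show (q : ℝ) * (S.outer (S.ρ ^ 2 * ε) - 1) = 0 by
      linarith)).resolve_left hq1.ne'
    linarith
  · have := (mul_eq_zero.mp (show (w : ℝ) * (S.outer (S.vertex * ε) - 1) = 0 by
      linarith)).resolve_left hw1.ne'
    linarith

lemma outer_mul_one_add_ρ_add_ρ_sq_ne_one {ε : R} (hε : S.TotPos ε) :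
    S.outer (ε * (1 + S.ρ + S.ρ ^ 2)) ≠ 1 := by
  intro h
  have e : ((2 : ℤ) : R) * (ε * (1 + S.ρ + S.ρ ^ 2)) =
      ε + S.ρ ^ 2 * ε + (1 + S.ρ) ^ 2 * ε := by
    push_cast; ring
  have e' := congrArg S.outer e
  rw [outer_add, outer_add, outer_intCast_mul, h] at e'
  push_cast at e'
  linarith [hε.one_le_outer, (S.totPos_ρ_sq.mul hε).one_le_outer,
    (S.totPos_one_add_ρ_sq.mul hε).one_le_outer]

theorem eq_of_mem_representatives {β γ : R} (hβ : β ∈ S.representatives)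
    (hγ : γ ∈ S.representatives) {ε : Rˣ} (hε : S.TotPos ε) (h : β = ε * γ) : β = γ := by
  have h' : γ = ((ε⁻¹ : Rˣ) : R) * β := by rw [h, Units.inv_mul_cancel_left]
  have key {β : R} (hβ : β ∈ S.representatives) :
      S.outer β = 1 ∨ β = 1 + S.ρ + S.ρ ^ 2 := by
    rcases hβ with (rfl | rfl) | hβ
    · exact Or.inl S.outer_one
    · exact Or.inr rfl
    · exact Or.inl (outer_of_mem_triangle hβ)
  rcases key hβ with hβ1 | rfl
  · rcases key hγ with hγ1 | rfl
    · rcases hβ with (rfl | rfl) | hβ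
      · rcases hγ with (rfl | rfl) | hγ
        · rfl
        · rw [h] at hβ1
          exact absurd hβ1 (S.outer_mul_one_add_ρ_add_ρ_sq_ne_one hε)
        · rw [h] at hβ1
          rw [h, S.eq_one_of_mul_mem_triangle hε hγ hβ1, one_mul]
      · rw [h'] at hγ1
        exact absurd hγ1 (S.outer_mul_one_add_ρ_add_ρ_sq_ne_one hε.inv)
      · rw [h'] at hγ1
        rw [h', S.eq_one_of_mul_mem_triangle hε.inv hβ hγ1, one_mul]
    · rw [h] at hβ1
      exact absurd hβ1 (S.outer_mul_one_add_ρ_add_ρ_sq_ne_one hε)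
  · rcases key hγ with hγ1 | rfl
    · rw [h'] at hγ1
      exact absurd hγ1 (S.outer_mul_one_add_ρ_add_ρ_sq_ne_one hε.inv)
    · rfl

theorem exists_finset_representatives : ∃ F : Finset R, (F : Set R) = S.representatives ∧
    (F.card : ℤ) = 2 + (a ^ 2 + 3 * a + 2) / 2 := by
  classical
  obtain ⟨n, hn⟩ : ∃ n : ℕ, (n : ℤ) = a + 1 :=
    ⟨(a + 1).toNat, Int.toNat_of_nonneg (by linarith [S.neg_one_le])⟩
  let τ : (_ : ℕ) × ℕ → R := fun i ↦ ((-(n - i.1 : ℤ) : ℤ) : R) +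
    (-((n - i.1) * (a + 2) + 1 + i.2 : ℤ) : ℤ) * S.ρ + ((n - i.1 : ℤ) + 1 : ℤ) * S.ρ ^ 2
  let I : Finset ((_ : ℕ) × ℕ) := (Finset.range (n + 1)).sigma Finset.range
  have hτ : Function.Injective τ := by
    rintro ⟨i, j⟩ ⟨i', j'⟩ h
    obtain ⟨h1, h2, -⟩ := S.rep_inj h
    simp only at h1 h2
    obtain rfl : i = i' := by omega
    obtain rfl : j = j' := by omega
    rfl
  have himage : ((I.image τ : Finset R) : Set R) = S.triangle := by
    ext α
    simp only [Finset.coe_image, Set.mem_image, Finset.mem_coe, I, Finset.mem_sigma,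
      Finset.mem_range]
    constructor
    · rintro ⟨⟨i, j⟩, ⟨hi, hj⟩, rfl⟩
      simp only at hi hj
      refine ⟨n - i, (n - i) * (a + 2) + 1 + j, by omega, by omega, by omega, ?_, ?_⟩
      · have : (j : ℤ) + 1 ≤ i := by exact_mod_cast hj
        nlinarith
      · simp only [τ]; push_cast; ring
    · rintro ⟨v, w, hv, hva, hw, hw', rfl⟩
      refine ⟨⟨(a + 1 - v).toNat, (w - (v * (a + 2) + 1)).toNat⟩, ⟨?_, ?_⟩, ?_⟩
      · simp only; omega
      · simp only
        zify
        rw [Int.toNat_of_nonneg (by linarith), Int.toNat_of_nonneg (by linarith)]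
        nlinarith
      · simp only [τ]
        rw [Int.toNat_of_nonneg (by linarith), Int.toNat_of_nonneg (by linarith), hn]
        push_cast; ring
  have htri {α : R} (x y z : ℤ) (h : α = x + y * S.ρ + z * S.ρ ^ 2) (hx : 0 < x) :
      α ∉ I.image τ := by
    rw [← Finset.mem_coe, himage]
    rintro ⟨v, w, hv, -, -, -, e⟩
    have := (S.rep_inj (x := x) (y := y) (z := z) (x' := -v) (y' := -w) (z' := v + 1)
      (by rw [← h, e]; push_cast; ring)).1
    omega
  have h1 : (1 : R) ∉ I.image τ := htri 1 0 0 (by simp) one_pos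
  have h2 : 1 + S.ρ + S.ρ ^ 2 ∉ I.image τ := htri 1 1 1 (by simp) one_pos
  have h12 : (1 : R) ≠ 1 + S.ρ + S.ρ ^ 2 := by
    intro h
    have := (S.rep_inj (x := 1) (y := 0) (z := 0) (x' := 1) (y' := 1) (z' := 1)
      (by simpa using h)).2.1
    omega
  refine ⟨insert 1 (insert (1 + S.ρ + S.ρ ^ 2) (I.image τ)), ?_, ?_⟩
  · rw [Finset.coe_insert, Finset.coe_insert, himage, representatives, Set.insert_union,
      Set.singleton_union]
  · rw [Finset.card_insert_of_notMem (by simp [h1, h12]), Finset.card_insert_of_notMem h2,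
      Finset.card_image_of_injective _ hτ, Finset.card_sigma]
    simp only [Finset.card_range]
    have hsum := Finset.sum_range_id_mul_two (n + 1)
    rw [Nat.add_sub_cancel] at hsum
    have hsum' : ((∑ i ∈ Finset.range (n + 1), i : ℕ) : ℤ) * 2 = a ^ 2 + 3 * a + 2 := by
      have : ((∑ i ∈ Finset.range (n + 1), i : ℕ) : ℤ) * 2 = (n + 1) * n := by
        exact_mod_cast hsum
      rw [this, hn]; ring
    push_cast at hsum' ⊢
    omega

end ShanksOrder

section NumberField

variable {K : Type*} [Field K]

lemma NumberField.exists_rep_of_adjoin_eq_top {a : ℤ} {ρ : 𝓞 K}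
    (hroot : ρ ^ 3 - (a : 𝓞 K) * ρ ^ 2 - ((a : 𝓞 K) + 3) * ρ - 1 = 0)
    (hgen : Algebra.adjoin ℤ {ρ} = (⊤ : Subalgebra ℤ (𝓞 K))) (α : 𝓞 K) :
    ∃ x y z : ℤ, α = x + y * ρ + z * ρ ^ 2 := by
  have hα : α ∈ Algebra.adjoin ℤ {ρ} := hgen ▸ Algebra.mem_top
  induction hα using Algebra.adjoin_induction with
  | mem x hx =>
    obtain rfl : x = ρ := hx
    exact ⟨0, 1, 0, by simp⟩
  | algebraMap n => exact ⟨n, 0, 0, by simp⟩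
  | add β γ _ _ hβ hγ =>
    obtain ⟨x, y, z, rfl⟩ := hβ
    obtain ⟨x', y', z', rfl⟩ := hγ
    exact ⟨x + x', y + y', z + z', by push_cast; ring⟩
  | mul β γ _ _ hβ hγ =>
    obtain ⟨x, y, z, rfl⟩ := hβ
    obtain ⟨x', y', z', rfl⟩ := hγ
    refine ⟨x * x' + (y * z' + z * y') + a * (z * z'),
      x * y' + y * x' + (a + 3) * (y * z' + z * y') + (a * (a + 3) + 1) * (z * z'),
      x * z' + y * y' + z * x' + a * (y * z' + z * y') + (a ^ 2 + a + 3) * (z * z'), ?_⟩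
    push_cast
    linear_combination ((y : 𝓞 K) * z' + z * y' + z * z' * (ρ + a)) * hroot

lemma NumberField.ringHom_ext_of_adjoin_eq_top [NumberField K] {A : Type*} [Field A] {ρ : 𝓞 K}
    (hgen : Algebra.adjoin ℤ {ρ} = (⊤ : Subalgebra ℤ (𝓞 K))) {φ ψ : K →+* A}
    (h : φ ρ = ψ ρ) : φ = ψ := by
  have h' : (φ.comp (algebraMap (𝓞 K) K)).toIntAlgHom =
      (ψ.comp (algebraMap (𝓞 K) K)).toIntAlgHom :=
    AlgHom.ext_of_adjoin_eq_top hgen (by rintro x rfl; exact h)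
  refine IsLocalization.ringHom_ext (nonZeroDivisors (𝓞 K)) ?_
  ext x
  exact DFunLike.congr_fun h' x

lemma shanks_root_eq {F : Type*} [Field F] {a t x : F} (ht : t ≠ 0) (ht' : 1 + t ≠ 0)
    (h : t ^ 3 - a * t ^ 2 - (a + 3) * t - 1 = 0) (hx : x ^ 3 - a * x ^ 2 - (a + 3) * x - 1 = 0) :
    x = t ∨ x = -(1 + t) / t ∨ x = -1 / (1 + t) := by
  have e : (x - t) * ((x - -(1 + t) / t) * (x - -1 / (1 + t))) = 0 := by
    field_simp
    linear_combination (t * (1 + t)) * hx - (x * (x + 1)) * h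
  rcases mul_eq_zero.mp e with h | h
  · exact Or.inl (sub_eq_zero.mp h)
  rcases mul_eq_zero.mp h with h | h
  · exact Or.inr (Or.inl (sub_eq_zero.mp h))
  · exact Or.inr (Or.inr (sub_eq_zero.mp h))

lemma NumberField.exists_real_embedding_of_shanks_root [NumberField K] {a : ℤ}
    (htr : ∀ φ : K →+* ℂ, NumberField.ComplexEmbedding.IsReal φ)
    (hdeg : Module.finrank ℚ K = 3) {ρ : 𝓞 K}
    (hroot : ρ ^ 3 - (a : 𝓞 K) * ρ ^ 2 - ((a : 𝓞 K) + 3) * ρ - 1 = 0)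
    (hgen : Algebra.adjoin ℤ {ρ} = (⊤ : Subalgebra ℤ (𝓞 K))) {t x : ℝ}
    (ht : t ≠ 0) (ht' : 1 + t ≠ 0) (h : t ^ 3 - a * t ^ 2 - (a + 3) * t - 1 = 0)
    (hx : x = t ∨ x = -(1 + t) / t ∨ x = -1 / (1 + t)) : ∃ σ : K →+* ℝ, σ ρ = x := by
  classical
  let e : (K →+* ℂ) → ℝ := fun φ ↦ (htr φ).embedding ρ
  have hinj : Function.Injective e := by
    intro φ ψ h
    refine NumberField.ringHom_ext_of_adjoin_eq_top hgen ?_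
    rw [← (htr φ).coe_embedding_apply, ← (htr ψ).coe_embedding_apply]
    exact congrArg _ h
  let T : Finset ℝ := {t, -(1 + t) / t, -1 / (1 + t)}
  have hsub : Finset.univ.image e ⊆ T := by
    intro y hy
    obtain ⟨φ, -, rfl⟩ := Finset.mem_image.mp hy
    have := congrArg ((htr φ).embedding.comp (algebraMap (𝓞 K) K)) hroot
    simp only [map_sub, map_mul, map_pow, map_add, map_intCast, map_one, map_ofNat,
      map_zero] at this
    simpa [T] using shanks_root_eq ht ht' h this
  have hcard : T.card ≤ (Finset.univ.image e).card := by
    rw [Finset.card_image_of_injective _ hinj, Finset.card_univ,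
      NumberField.Embeddings.card K ℂ, hdeg]
    exact Finset.card_le_three
  have hxT : x ∈ Finset.univ.image e := by
    rw [Finset.eq_of_subset_of_card_le hsub hcard]
    simpa [T] using hx
  obtain ⟨φ, -, rfl⟩ := Finset.mem_image.mp hxT
  exact ⟨_, rfl⟩

end NumberField

lemma exists_shanksOrder {a : ℤ} (ha : -1 ≤ a) {K : Type*} [Field K] [NumberField K]
    (htr : ∀ φ : K →+* ℂ, NumberField.ComplexEmbedding.IsReal φ)
    (hdeg : Module.finrank ℚ K = 3) {ρ : 𝓞 K}
    (hroot : ρ ^ 3 - (a : 𝓞 K) * ρ ^ 2 - ((a : 𝓞 K) + 3) * ρ - 1 = 0)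
    (hgen : Algebra.adjoin ℤ {ρ} = (⊤ : Subalgebra ℤ (𝓞 K))) (ι : K →+* ℝ)
    (hmax : ∀ σ : K →+* ℝ, σ (ρ : K) ≤ ι (ρ : K)) :
    ∃ S : ShanksOrder (𝓞 K) a, S.ρ = ρ ∧
      ∀ α : 𝓞 K, S.TotPos α ↔ ∀ σ : K →+* ℝ, 0 < σ (α : K) := by
  have haR : (-1 : ℝ) ≤ a := by exact_mod_cast ha
  have hσ (σ : K →+* ℝ) : σ ρ ^ 3 - a * σ ρ ^ 2 - (a + 3) * σ ρ - 1 = 0 := by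
    have := congrArg (σ.comp (algebraMap (𝓞 K) K)) hroot
    simp only [map_sub, map_mul, map_pow, map_add, map_intCast, map_one, map_ofNat,
      map_zero] at this
    exact this
  obtain ⟨t, ht⟩ : ∃ t, t = ι ρ := ⟨_, rfl⟩
  have hroot_t := hσ ι
  rw [← ht] at hroot_t
  have ht0 : t ≠ 0 := by rintro rfl; norm_num at hroot_t
  have ht1 : 1 + t ≠ 0 := by
    intro h
    obtain rfl : t = -1 := by linarith
    norm_num at hroot_t
    linarith
  have hex {x : ℝ} (hx : x = t ∨ x = -(1 + t) / t ∨ x = -1 / (1 + t)) : ∃ σ : K →+* ℝ, σ ρ = x :=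
    NumberField.exists_real_embedding_of_shanks_root htr hdeg hroot hgen ht0 ht1 hroot_t hx
  obtain ⟨σ₁, h₁⟩ := hex (Or.inr (Or.inl rfl))
  obtain ⟨σ₂, h₂⟩ := hex (Or.inr (Or.inr rfl))
  have hQ : 0 < t ^ 2 + t + 1 := by nlinarith [sq_nonneg (t + 1)]
  have hpos1 : 0 < 1 + t := by
    have h := hmax σ₂
    rw [h₂, ← ht] at h
    by_contra! hneg
    have hlt : 1 + t < 0 := lt_of_le_of_ne hneg ht1
    rw [div_le_iff_of_neg hlt] at h
    nlinarith
  have hpos : 0 < t := by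
    have h := hmax σ₁
    rw [h₁, ← ht] at h
    by_contra! hneg
    have hlt : t < 0 := lt_of_le_of_ne hneg ht0
    rw [div_le_iff_of_neg hlt] at h
    nlinarith
  have hlt : (a : ℝ) + 1 < t := by
    by_contra! hle
    nlinarith [mul_nonneg (mul_nonneg hpos.le hpos1.le) (sub_nonneg.mpr hle)]
  refine ⟨{ ρ := ρ
            top := ι.comp (algebraMap (𝓞 K) K)
            bot := σ₁.comp (algebraMap (𝓞 K) K)
            mid := σ₂.comp (algebraMap (𝓞 K) K)
            neg_one_le := ha
            root := hroot
            exists_rep := NumberField.exists_rep_of_adjoin_eq_top hroot hgen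
            lt_top := hlt.trans_eq ht
            top_pos := hpos.trans_eq ht
            bot_ρ := h₁.trans (by rw [ht]; rfl)
            mid_ρ := h₂.trans (by rw [ht]; rfl) },
    rfl, fun α ↦ ⟨fun h σ ↦ ?_, fun h ↦ ⟨h _, h _, h _⟩⟩⟩
  have hext {τ : K →+* ℝ} (e : σ ρ = τ ρ) : σ = τ :=
    NumberField.ringHom_ext_of_adjoin_eq_top hgen e
  rcases shanks_root_eq ht0 ht1 hroot_t (hσ σ) with e | e | e
  · rw [hext (e.trans ht)]
    exact h.1
  · rw [hext (e.trans h₁.symm)]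
    exact h.2.1
  · rw [hext (e.trans h₂.symm)]
    exact h.2.2

/-- **Indecomposables in the simplest cubic fields** (Kala–Tinková).
Let `a ≥ -1`, let `K = ℚ(ρ)` be the simplest cubic field, where `ρ ∈ 𝓞 K` is the
largest real root of `f(x) = x³ - ax² - (a+3)x - 1` (largest with respect to a
fixed real embedding `ι`, i.e. `σ(ρ) ≤ ι(ρ)` for every real embedding `σ`), and
assume `𝓞 K = ℤ[ρ]`.  Then a totally positive `α ∈ 𝓞 K` is indecomposable if and
only if `α = ε·β` for a totally positive unit `ε` and `β` in the set
`{1, 1 + ρ + ρ²} ∪ {-v - wρ + (v+1)ρ² : 0 ≤ v ≤ a, v(a+2)+1 ≤ w ≤ (v+1)(a+1)}`;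
in particular, up to multiplication by totally positive units there are exactly
`2 + (a² + 3a + 2)/2` indecomposables. -/
theorem simplest_cubic_indecomposables
    (a : ℤ) (ha : -1 ≤ a)
    (K : Type) [Field K] [NumberField K]
    (htr : ∀ φ : K →+* ℂ, NumberField.ComplexEmbedding.IsReal φ)
    (hdeg : Module.finrank ℚ K = 3)
    (ρ : 𝓞 K)
    (hρroot : ρ ^ 3 - (a : 𝓞 K) * ρ ^ 2 - ((a : 𝓞 K) + 3) * ρ - 1 = 0)
    (hgen : Algebra.adjoin ℤ {ρ} = (⊤ : Subalgebra ℤ (𝓞 K)))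
    (ι : K →+* ℝ)
    (hmax : ∀ σ : K →+* ℝ, σ (ρ : K) ≤ ι (ρ : K)) :
    (∀ α : 𝓞 K, (∀ σ : K →+* ℝ, 0 < σ (α : K)) →
      ((¬ ∃ β γ : 𝓞 K, (∀ σ : K →+* ℝ, 0 < σ (β : K)) ∧
          (∀ σ : K →+* ℝ, 0 < σ (γ : K)) ∧ α = β + γ) ↔
        ∃ ε : (𝓞 K)ˣ, (∀ σ : K →+* ℝ, 0 < σ ((ε : 𝓞 K) : K)) ∧
          ∃ β ∈ ({1, 1 + ρ + ρ ^ 2} : Set (𝓞 K)) ∪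
            {x : 𝓞 K | ∃ v w : ℤ, 0 ≤ v ∧ v ≤ a ∧
              v * (a + 2) + 1 ≤ w ∧ w ≤ (v + 1) * (a + 1) ∧
              x = -(v : 𝓞 K) - (w : 𝓞 K) * ρ + ((v : 𝓞 K) + 1) * ρ ^ 2},
            α = (ε : 𝓞 K) * β)) ∧
    (∃ S : Finset (𝓞 K),
      (S : Set (𝓞 K)) = ({1, 1 + ρ + ρ ^ 2} : Set (𝓞 K)) ∪
        {x : 𝓞 K | ∃ v w : ℤ, 0 ≤ v ∧ v ≤ a ∧
          v * (a + 2) + 1 ≤ w ∧ w ≤ (v + 1) * (a + 1) ∧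
          x = -(v : 𝓞 K) - (w : 𝓞 K) * ρ + ((v : 𝓞 K) + 1) * ρ ^ 2} ∧
      (S.card : ℤ) = 2 + (a ^ 2 + 3 * a + 2) / 2 ∧
      ∀ β₁ ∈ S, ∀ β₂ ∈ S,
        (∃ ε : (𝓞 K)ˣ, (∀ σ : K →+* ℝ, 0 < σ ((ε : 𝓞 K) : K)) ∧
          β₁ = (ε : 𝓞 K) * β₂) → β₁ = β₂) := by
  obtain ⟨S, rfl, hS⟩ := exists_shanksOrder ha htr hdeg hρroot hgen ι hmax
  simp only [← hS]
  refine ⟨fun α hα ↦ S.indec_iff hα, ?_⟩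
  obtain ⟨F, hF, hcard⟩ := S.exists_finset_representatives
  refine ⟨F, hF, hcard, fun β hβ γ hγ ↦ ?_⟩
  rintro ⟨ε, hε, h⟩
  exact S.eq_of_mem_representatives (hF ▸ Finset.mem_coe.mpr hβ) (hF ▸ Finset.mem_coe.mpr hγ) hε h
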